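/- There is no probability measure P on Ω⁴ = {−1,+1}⁴ such that for every (s,t) ∈ Θ and every (a,b) ∈ Ω², P({τ ∈ Ω⁴ : τ^s = a, τ^t = b}) = p(a,b|s,t). In other words, no single joint distribution on the four preassigned outcomes has all four pairwise marginals prescribed by the CHSH table. -/

import Mathlib

open MeasureTheory

/-- The two-point set `{+1, -1}` of measurement outcomes. -/
abbrev Sign := ({1, -1} : Finset ℤ)

/-- The four preassigned outcomes: an element of `Ω⁴`. -/
abbrev O4 := Sign × Sign × Sign × Sign

/-- The `s`-th coordinate of a quadruple `τ ∈ Ω⁴`, for `s ∈ {1,2,3,4}`. -/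
def coord (τ : O4) : ℕ → ℤ
  | 1 => τ.1
  | 2 => τ.2.1
  | 3 => τ.2.2.1
  | 4 => τ.2.2.2
  | _ => 1

noncomputable def mu : ℝ := (2 - Real.sqrt 2) / 8
noncomputable def nu : ℝ := (2 + Real.sqrt 2) / 8

/-- The CHSH table `p(a,b|s,t)`: equals `μ` on the diagonal (`a = b`) and `ν`
off the diagonal for `(s,t) ∈ {(1,3),(2,3),(2,4)}`, with the roles of `μ` and `ν`
swapped for `(s,t) = (1,4)`. -/
noncomputable def chshP (a b : Sign) (s t : ℕ) : ℝ :=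
  if s = 1 ∧ t = 4 then (if a = b then nu else mu) else (if a = b then mu else nu)

/-- **No joint distribution reproduces the CHSH table.**
There is no probability measure `P` on `Ω⁴ = {−1,+1}⁴` whose pairwise marginals
`P({τ : τˢ = a, τᵗ = b})` are given by the CHSH table for all `(s,t) ∈ Θ` and
`(a,b) ∈ Ω²`. -/
theorem no_joint_distribution_for_chsh_table :
    ¬ ∃ P : Measure O4, IsProbabilityMeasure P ∧
      ∀ s ∈ ({1, 2} : Finset ℕ), ∀ t ∈ ({3, 4} : Finset ℕ), ∀ a b : Sign,
        (P {τ : O4 | coord τ s = (a : ℤ) ∧ coord τ t = (b : ℤ)}).toReal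
          = chshP a b s t := by
  rintro ⟨P, hP, h⟩
  let p : Sign := ⟨1, by simp⟩
  let m : Sign := ⟨-1, by simp⟩
  let E (s t : ℕ) (a : Sign) : Set O4 := {τ | coord τ s = (a : ℤ) ∧ coord τ t = (a : ℤ)}
  have hE14 : P.real (E 1 4 p) = nu := (h 1 (by simp) 4 (by simp) p p).trans (by simp [chshP])
  have hE13 : P.real (E 1 3 p) = mu := (h 1 (by simp) 3 (by simp) p p).trans (by simp [chshP])
  have hE23 : P.real (E 2 3 m) = mu := (h 2 (by simp) 3 (by simp) m m).trans (by simp [chshP])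
  have hE24 : P.real (E 2 4 p) = mu := (h 2 (by simp) 4 (by simp) p p).trans (by simp [chshP])
  have hsub : E 1 4 p ⊆ E 1 3 p ∪ E 2 3 m ∪ E 2 4 p := by
    rintro ⟨w, x, y, z⟩ ⟨hw, hz⟩
    have hx : (x : ℤ) = 1 ∨ (x : ℤ) = -1 := by
      simpa only [Finset.mem_insert, Finset.mem_singleton] using x.2
    have hy : (y : ℤ) = 1 ∨ (y : ℤ) = -1 := by
      simpa only [Finset.mem_insert, Finset.mem_singleton] using y.2
    simp only [E, p, m, coord, Set.mem_union, Set.mem_ofPred_eq] at hw hz ⊢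
    tauto
  have hle : P.real (E 1 4 p) ≤ P.real (E 1 3 p) + P.real (E 2 3 m) + P.real (E 2 4 p) :=
    (measureReal_mono hsub).trans <| (measureReal_union_le _ _).trans <| by
      gcongr
      exact measureReal_union_le _ _
  rw [hE14, hE13, hE23, hE24, mu, nu] at hle
  have hsqrt : 1 < Real.sqrt 2 := Real.lt_sqrt_of_sq_lt (by norm_num)
  linarith
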